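/- For every semantics sem ∈ {grounded, complete, preferred, stable} and every formula φ: A ∪ S |~^∩_sem φ holds in the ABA-framework (every sem-extension contains an ABA-argument for φ) if and only if A ∪ S |~^∩_sem φ holds in the corresponding sequent-based ABA-framework (every sem-extension contains an assumptive sequent argument A' ⟨ Γ ⇒ φ with A' ⊆ A, Γ ⊆ S). -/

import Mathlib

/-- A rule `φ₁,…,φₙ → φ` of a deductive system: premises and a conclusion. -/
abbrev Rule (F : Type) := List F × F

/-- Deducibility `Γ ⊢^R φ`: chaining rules of `R` from members of `Γ`. -/
inductive Ded {F : Type} (R : Set (Rule F)) (Γ : Set F) : F → Prop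
  | mem {φ : F} : φ ∈ Γ → Ded R Γ φ
  | app {l : List F} {φ : F} : (l, φ) ∈ R → (∀ ψ ∈ l, Ded R Γ ψ) → Ded R Γ φ

/-- Derivability of assumptive sequents `A' ⟨ Γ ⇒ Δ` in the calculus `R_⇒`:
the sequents `μ(r)` for `r ∈ R`, the identity axiom, the two cut rules, and the
rules `AS_ABA` moving a formula of the assumption set `AS` between the
assumption component and the left-hand side of `⇒`. -/
inductive SeqDer {F : Type} [DecidableEq F] (R : Set (Rule F)) (AS : Set F) :
    Finset F → Finset F → Finset F → Prop
  | id (φ : F) : SeqDer R AS ∅ {φ} {φ}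
  | mu {l : List F} {φ : F} : (l, φ) ∈ R → SeqDer R AS ∅ l.toFinset {φ}
  | cutLhs {A₁ A₂ Γ₁ Γ₂ Δ₁ Δ₂ : Finset F} {φ : F} :
      SeqDer R AS A₁ Γ₁ (insert φ Δ₁) → SeqDer R AS A₂ (insert φ Γ₂) Δ₂ →
      SeqDer R AS (A₁ ∪ A₂) (Γ₁ ∪ Γ₂) (Δ₁ ∪ Δ₂)
  | cutAss {A₁ A₂ Γ₁ Γ₂ Δ₁ Δ₂ : Finset F} {φ : F} :
      SeqDer R AS A₁ Γ₁ (insert φ Δ₁) → SeqDer R AS (insert φ A₂) Γ₂ Δ₂ →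
      SeqDer R AS (A₁ ∪ A₂) (Γ₁ ∪ Γ₂) (Δ₁ ∪ Δ₂)
  | toAss {A' Γ Δ : Finset F} {φ : F} :
      φ ∈ AS → SeqDer R AS A' (insert φ Γ) Δ → SeqDer R AS (insert φ A') Γ Δ
  | toLhs {A' Γ Δ : Finset F} {φ : F} :
      φ ∈ AS → SeqDer R AS (insert φ A') Γ Δ → SeqDer R AS A' (insert φ Γ) Δ

/-- An argument: an assumption component, a support (strict premises) and a conclusion. -/
structure Argu (F : Type) where
  ass : Finset F
  supp : Finset F
  concl : F

/-- `a` is an ABA-argument based on `S` and `A`: a deduction `ass(a) ∪ supp(a) ⊢^R conc(a)`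
with finite `ass(a) ⊆ A` and finite `supp(a) ⊆ S`. -/
def IsABAArg {F : Type} (R : Set (Rule F)) (S A : Set F) (a : Argu F) : Prop :=
  ↑a.ass ⊆ A ∧ ↑a.supp ⊆ S ∧ Ded R (↑a.ass ∪ ↑a.supp) a.concl

/-- `a` is an assumptive sequent argument based on `S` and `A`: a sequent
`ass(a) ⟨ supp(a) ⇒ conc(a)` derivable in `R_⇒`, with `ass(a) ⊆ A` and `supp(a) ⊆ S`. -/
def IsSeqArg {F : Type} [DecidableEq F] (R : Set (Rule F)) (S A : Set F) (a : Argu F) : Prop :=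
  ↑a.ass ⊆ A ∧ ↑a.supp ⊆ S ∧ SeqDer R A a.ass a.supp {a.concl}

/-- `a` attacks `b` iff the conclusion of `a` is the contrary of some assumption of `b`
(this is the ABA attack, and also the sequent-based `AT_ABA` attack). -/
def Attacks {F : Type} (contrary : F → F) (a b : Argu F) : Prop :=
  ∃ ψ ∈ b.ass, a.concl = contrary ψ

/-- `E` is conflict-free: a set of arguments of the framework no member of which attacks a member. -/
def ConflictFree {α : Type} (Args : Set α) (att : α → α → Prop) (E : Set α) : Prop :=
  E ⊆ Args ∧ ∀ a ∈ E, ∀ b ∈ E, ¬ att a b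

/-- `E` defends `a`: `E` attacks every attacker of `a`. -/
def Defends {α : Type} (Args : Set α) (att : α → α → Prop) (E : Set α) (a : α) : Prop :=
  ∀ b ∈ Args, att b a → ∃ c ∈ E, att c b

/-- `E` is admissible: conflict-free and defending all of its elements. -/
def Admissible {α : Type} (Args : Set α) (att : α → α → Prop) (E : Set α) : Prop :=
  ConflictFree Args att E ∧ ∀ a ∈ E, Defends Args att E a

/-- A complete extension: an admissible set containing every argument it defends. -/
def CompleteExt {α : Type} (Args : Set α) (att : α → α → Prop) (E : Set α) : Prop :=
  Admissible Args att E ∧ ∀ a ∈ Args, Defends Args att E a → a ∈ E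

/-- The grounded extension: the ⊆-minimal complete extension. -/
def GroundedExt {α : Type} (Args : Set α) (att : α → α → Prop) (E : Set α) : Prop :=
  CompleteExt Args att E ∧ ∀ E', CompleteExt Args att E' → E ⊆ E'

/-- A preferred extension: a ⊆-maximal complete extension. -/
def PreferredExt {α : Type} (Args : Set α) (att : α → α → Prop) (E : Set α) : Prop :=
  CompleteExt Args att E ∧ ∀ E', CompleteExt Args att E' → E ⊆ E' → E' = E

/-- A set `A'` of assumptions is consistent iff there is no `φ ∈ A'` with
`A'' ∪ Γ ⊢^R φ̄` for some `A'' ⊆ A'` and `Γ ⊆ S`. -/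
def ConsistentSet {F : Type} (R : Set (Rule F)) (contrary : F → F) (S : Set F)
    (A' : Set F) : Prop :=
  ¬ ∃ φ ∈ A', ∃ A'' ⊆ A', ∃ Γ ⊆ S, Ded R (A'' ∪ Γ) (contrary φ)

/-- `MCS(S,A)`: the set of ⊆-maximal consistent subsets of `A`. -/
def MCS {F : Type} (R : Set (Rule F)) (contrary : F → F) (S A : Set F) : Set (Set F) :=
  {T | T ⊆ A ∧ ConsistentSet R contrary S T ∧
    ∀ T', T ⊆ T' → T' ⊆ A → ConsistentSet R contrary S T' → T' = T}

/-- `CN(T) = {φ | Γ ⊢^R φ for some Γ ⊆ T}`. -/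
def CN {F : Type} (R : Set (Rule F)) (T : Set F) : Set F :=
  {φ | ∃ Γ ⊆ T, Ded R Γ φ}

/-- `⊢^R` is contrapositive for assumptions: for all `φ, ψ` in an assumption set `A'`
and `Γ ⊆ S`, `A' ∪ Γ ⊢^R ψ̄` iff `(A' \ {φ}) ∪ {ψ} ∪ Γ ⊢^R φ̄`. -/
def Contrapositive {F : Type} (R : Set (Rule F)) (contrary : F → F) (S A : Set F) : Prop :=
  ∀ A' ⊆ A, ∀ Γ ⊆ S, ∀ φ ∈ A', ∀ ψ ∈ A',
    (Ded R (A' ∪ Γ) (contrary ψ) ↔ Ded R ((A' \ {φ}) ∪ {ψ} ∪ Γ) (contrary φ))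

/-- A stable extension: a complete extension attacking every argument not in it. -/
def StableExt {α : Type} (Args : Set α) (att : α → α → Prop) (E : Set α) : Prop :=
  CompleteExt Args att E ∧ ∀ a ∈ Args, a ∉ E → ∃ b ∈ E, att b a

/-- The four semantics: grounded, complete, preferred and stable. -/
inductive Sem | grd | cmp | prf | stb

/-- The extensions of a framework under a semantics. -/
def ExtOf {α : Type} (Args : Set α) (att : α → α → Prop) : Sem → Set α → Prop
  | .grd => GroundedExt Args att
  | .cmp => CompleteExt Args att
  | .prf => PreferredExt Args att
  | .stb => StableExt Args att

/-! ### Soundness and completeness of the sequent calculus for deducibility -/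

theorem Ded.mono {F : Type} {R : Set (Rule F)} {Γ Γ' : Set F} {φ : F}
    (h : Ded R Γ φ) (hΓ : Γ ⊆ Γ') : Ded R Γ' φ := by
  induction h with
  | mem h => exact .mem (hΓ h)
  | app hr _ ih => exact .app hr ih

theorem Ded.trans {F : Type} {R : Set (Rule F)} {Γ Γ' : Set F} {φ : F}
    (h : Ded R Γ φ) (hΓ : ∀ ψ ∈ Γ, Ded R Γ' ψ) : Ded R Γ' φ := by
  induction h with
  | mem h => exact hΓ _ h
  | app hr _ ih => exact .app hr ih

/-- Some formula on the right-hand side of a derivable sequent is deducible from the left. -/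
theorem SeqDer.exists_ded {F : Type} [DecidableEq F] {R : Set (Rule F)} {AS : Set F}
    {A' Γ Δ : Finset F} (h : SeqDer R AS A' Γ Δ) :
    ∃ δ ∈ Δ, Ded R ((A' : Set F) ∪ Γ) δ := by
  have cut : ∀ {T₁ T₂ T : Set F} {Δ₁ Δ₂ : Finset F} {φ : F},
      (∃ δ ∈ insert φ Δ₁, Ded R T₁ δ) → (∃ δ ∈ Δ₂, Ded R T₂ δ) → T₁ ⊆ T →
      T₂ ⊆ insert φ T → ∃ δ ∈ Δ₁ ∪ Δ₂, Ded R T δ := by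
    rintro T₁ T₂ T Δ₁ Δ₂ φ ⟨δ, hδ, h₁⟩ ⟨ε, hε, h₂⟩ hT₁ hT₂
    rcases Finset.mem_insert.1 hδ with rfl | hδ
    · refine ⟨ε, Finset.mem_union_right _ hε, h₂.trans fun ψ hψ => ?_⟩
      rcases hT₂ hψ with rfl | hψ
      · exact h₁.mono hT₁
      · exact .mem hψ
    · exact ⟨δ, Finset.mem_union_left _ hδ, h₁.mono hT₁⟩
  induction h with
  | id φ => exact ⟨φ, by simp, .mem (by simp)⟩
  | mu hr => exact ⟨_, by simp, .app hr fun ψ hψ => .mem (by simp [hψ])⟩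
  | cutLhs _ _ ih₁ ih₂ =>
    refine cut ih₁ ih₂ ?_ ?_ <;> intro x <;> simp <;> tauto
  | cutAss _ _ ih₁ ih₂ =>
    refine cut ih₁ ih₂ ?_ ?_ <;> intro x <;> simp <;> tauto
  | toAss _ _ ih =>
    obtain ⟨δ, hδ, h⟩ := ih
    exact ⟨δ, hδ, h.mono (by intro x; simp [or_assoc])⟩
  | toLhs _ _ ih =>
    obtain ⟨δ, hδ, h⟩ := ih
    exact ⟨δ, hδ, h.mono (by intro x; simp [or_assoc])⟩

theorem SeqDer.ded {F : Type} [DecidableEq F] {R : Set (Rule F)} {AS : Set F}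
    {A' Γ : Finset F} {φ : F} (h : SeqDer R AS A' Γ {φ}) : Ded R ((A' : Set F) ∪ Γ) φ := by
  obtain ⟨δ, hδ, h⟩ := h.exists_ded
  rwa [Finset.mem_singleton.1 hδ] at h

/-- Cutting simultaneously all formulas of `L`. -/
theorem SeqDer.cut_all {F : Type} [DecidableEq F] {R : Set (Rule F)} {AS T : Set F} {φ : F}
    (L : Finset F) :
    ∀ P : Finset F, ↑P ⊆ T →
      (∀ ψ ∈ L, ∃ Γ : Finset F, ↑Γ ⊆ T ∧ SeqDer R AS ∅ Γ {ψ}) → SeqDer R AS ∅ (L ∪ P) {φ} →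
      ∃ Γ : Finset F, ↑Γ ⊆ T ∧ SeqDer R AS ∅ Γ {φ} := by
  induction L using Finset.induction_on with
  | empty => exact fun P hP _ h => ⟨P, hP, by simpa using h⟩
  | insert ψ L _ ih =>
    intro P hP hL h
    obtain ⟨Γ, hΓ, hψ⟩ := hL ψ (Finset.mem_insert_self _ _)
    refine ih (Γ ∪ P) (by simp [hΓ, hP]) (fun χ hχ => hL χ (Finset.mem_insert_of_mem hχ)) ?_
    rw [Finset.insert_union] at h
    have := SeqDer.cutLhs (Δ₁ := ∅) hψ h
    rwa [Finset.empty_union, Finset.empty_union, Finset.union_left_comm] at this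

theorem Ded.exists_seqDer {F : Type} [DecidableEq F] {R : Set (Rule F)} {AS T : Set F} {φ : F}
    (h : Ded R T φ) : ∃ Γ : Finset F, ↑Γ ⊆ T ∧ SeqDer R AS ∅ Γ {φ} := by
  induction h with
  | mem h => exact ⟨{_}, by simpa using h, .id _⟩
  | app hr _ ih =>
    refine SeqDer.cut_all _ ∅ (by simp) (fun ψ hψ => ih ψ (List.mem_toFinset.1 hψ)) ?_
    rw [Finset.union_empty]
    exact .mu hr

theorem SeqDer.move_to_ass {F : Type} [DecidableEq F] {R : Set (Rule F)} {AS : Set F}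
    {Γ Δ : Finset F} (B : Finset F) (hB : ↑B ⊆ AS) :
    ∀ A' : Finset F, SeqDer R AS A' (B ∪ Γ) Δ → SeqDer R AS (B ∪ A') Γ Δ := by
  induction B using Finset.induction_on with
  | empty => simp
  | insert ψ B _ ih =>
    intro A' h
    rw [Finset.coe_insert, Set.insert_subset_iff] at hB
    rw [Finset.insert_union] at h
    rw [Finset.insert_union, ← Finset.union_insert]
    exact ih hB.2 _ (.toAss hB.1 h)

theorem IsSeqArg.isABAArg {F : Type} [DecidableEq F] {R : Set (Rule F)} {S A : Set F}
    {a : Argu F} (h : IsSeqArg R S A a) : IsABAArg R S A a :=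
  ⟨h.1, h.2.1, h.2.2.ded⟩

theorem IsABAArg.exists_isSeqArg {F : Type} [DecidableEq F] {R : Set (Rule F)} {S A : Set F}
    {a : Argu F} (h : IsABAArg R S A a) :
    ∃ b, IsSeqArg R S A b ∧ b.concl = a.concl ∧ b.ass ⊆ a.ass := by
  obtain ⟨hA, hS, hd⟩ := h
  obtain ⟨Γ, hΓ, hs⟩ := hd.exists_seqDer (AS := A)
  have hass : Γ ∩ a.ass ⊆ a.ass := Finset.inter_subset_right
  have hA' : (↑(Γ ∩ a.ass) : Set F) ⊆ A := (Finset.coe_subset.2 hass).trans hA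
  refine ⟨⟨Γ ∩ a.ass, Γ \ a.ass, a.concl⟩, ⟨hA', fun x hx => ?_, ?_⟩, rfl, hass⟩
  · obtain ⟨hx, hxa⟩ := Finset.mem_sdiff.1 (Finset.mem_coe.1 hx)
    exact hS ((hΓ hx).resolve_left hxa)
  · have := SeqDer.move_to_ass (R := R) (Γ := Γ \ a.ass) (Δ := {a.concl}) _ hA' ∅
    rw [Finset.union_empty, Finset.union_comm (Γ ∩ a.ass), Finset.sdiff_union_inter] at this
    exact this hs

/-! ### Restricting a framework to a subset of its arguments that dominates it -/

/-- Every argument is represented in `Args'` by one that attacks at least as much and is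
attacked by at most as much. -/
def Dominates {α : Type} (Args Args' : Set α) (att : α → α → Prop) : Prop :=
  Args' ⊆ Args ∧ ∀ a ∈ Args, ∃ a' ∈ Args', (∀ b, att a b → att a' b) ∧ ∀ b, att b a' → att b a

/-- The arguments of `Args` defended by `E'` within `Args'`. -/
def defendedBy {α : Type} (Args Args' : Set α) (att : α → α → Prop) (E' : Set α) : Set α :=
  {a ∈ Args | Defends Args' att E' a}

section Dominates

variable {α : Type} {Args Args' E E' : Set α} {att : α → α → Prop}

theorem Defends.anti {a a' : α} (h : Defends Args att E a) (ha : ∀ b, att b a' → att b a) :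
    Defends Args att E a' :=
  fun b hb hba => h b hb (ha b hba)

theorem CompleteExt.mem_iff (h : CompleteExt Args att E) {a : α} :
    a ∈ E ↔ a ∈ Args ∧ Defends Args att E a :=
  ⟨fun ha => ⟨h.1.1.1 ha, h.1.2 a ha⟩, fun ha => h.2 a ha.1 ha.2⟩

theorem CompleteExt.exists_mem_inter (hD : Dominates Args Args' att) (h : CompleteExt Args att E)
    {a : α} (ha : a ∈ E) : ∃ a' ∈ E ∩ Args', ∀ b, att a b → att a' b := by
  obtain ⟨a', ha', hout, hin⟩ := hD.2 a (h.1.1.1 ha)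
  exact ⟨a', ⟨h.mem_iff.2 ⟨hD.1 ha', (h.1.2 a ha).anti hin⟩, ha'⟩, hout⟩

theorem Dominates.defends_of_defends (hD : Dominates Args Args' att) (hE : E' ⊆ E) {a : α}
    (h : Defends Args' att E' a) : Defends Args att E a := by
  intro b hb hba
  obtain ⟨b', hb', hout, hin⟩ := hD.2 b hb
  obtain ⟨c, hc, hcb⟩ := h b' hb' (hout a hba)
  exact ⟨c, hE hc, hin c hcb⟩

theorem CompleteExt.defends_inter_iff (hD : Dominates Args Args' att)
    (h : CompleteExt Args att E) {a : α} :
    Defends Args' att (E ∩ Args') a ↔ Defends Args att E a := by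
  refine ⟨hD.defends_of_defends Set.inter_subset_left, fun ha b hb hba => ?_⟩
  obtain ⟨c, hc, hcb⟩ := ha b (hD.1 hb) hba
  obtain ⟨c', hc', hout⟩ := h.exists_mem_inter hD hc
  exact ⟨c', hc', hout b hcb⟩

theorem CompleteExt.inter (hD : Dominates Args Args' att) (h : CompleteExt Args att E) :
    CompleteExt Args' att (E ∩ Args') :=
  ⟨⟨⟨Set.inter_subset_right, fun a ha b hb => h.1.1.2 a ha.1 b hb.1⟩,
    fun a ha => (h.defends_inter_iff hD).2 (h.1.2 a ha.1)⟩,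
    fun _ ha hd => ⟨h.mem_iff.2 ⟨hD.1 ha, (h.defends_inter_iff hD).1 hd⟩, ha⟩⟩

theorem CompleteExt.defendedBy_inter (hD : Dominates Args Args' att)
    (h : CompleteExt Args att E) : defendedBy Args Args' att (E ∩ Args') = E := by
  ext a
  rw [h.mem_iff, ← h.defends_inter_iff hD]
  rfl

theorem CompleteExt.inter_defendedBy (hD : Dominates Args Args' att)
    (h : CompleteExt Args' att E') : defendedBy Args Args' att E' ∩ Args' = E' := by
  ext a
  rw [h.mem_iff]
  exact ⟨fun ha => ⟨ha.2, ha.1.2⟩, fun ha => ⟨⟨hD.1 ha.1, ha.2⟩, ha.1⟩⟩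

theorem CompleteExt.subset_defendedBy (hD : Dominates Args Args' att)
    (h : CompleteExt Args' att E') : E' ⊆ defendedBy Args Args' att E' :=
  fun _ ha => ⟨hD.1 (h.1.1.1 ha), h.1.2 _ ha⟩

theorem CompleteExt.exists_mem_of_mem_defendedBy (hD : Dominates Args Args' att)
    (h : CompleteExt Args' att E') {a : α} (ha : a ∈ defendedBy Args Args' att E') :
    ∃ a' ∈ E', ∀ b, att a b → att a' b := by
  obtain ⟨a', ha', hout, hin⟩ := hD.2 a ha.1
  exact ⟨a', h.mem_iff.2 ⟨ha', ha.2.anti hin⟩, hout⟩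

theorem CompleteExt.defendedBy (hD : Dominates Args Args' att) (h : CompleteExt Args' att E') :
    CompleteExt Args att (defendedBy Args Args' att E') := by
  refine ⟨⟨⟨fun a ha => ha.1, fun a ha b hb hab => ?_⟩, fun a ha =>
    hD.defends_of_defends (h.subset_defendedBy hD) ha.2⟩, fun a ha hd => ⟨ha, fun b hb hba => ?_⟩⟩
  · obtain ⟨a', ha', hout⟩ := h.exists_mem_of_mem_defendedBy hD ha
    obtain ⟨c, hc, hca⟩ := hb.2 a' (h.1.1.1 ha') (hout b hab)
    exact h.1.1.2 c hc a' ha' hca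
  · obtain ⟨c, hc, hcb⟩ := hd b (hD.1 hb) hba
    obtain ⟨c', hc', hout⟩ := h.exists_mem_of_mem_defendedBy hD hc
    exact ⟨c', hc', hout b hcb⟩

theorem defendedBy_mono {E₁ E₂ : Set α} (h : E₁ ⊆ E₂) :
    defendedBy Args Args' att E₁ ⊆ defendedBy Args Args' att E₂ := by
  refine fun a ha => ⟨ha.1, fun b hb hba => ?_⟩
  obtain ⟨c, hc, hcb⟩ := ha.2 b hb hba
  exact ⟨c, h hc, hcb⟩

theorem ExtOf.completeExt {sem : Sem} (h : ExtOf Args att sem E) : CompleteExt Args att E := by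
  cases sem
  exacts [h.1, h, h.1, h.1]

theorem ExtOf.inter (hD : Dominates Args Args' att) {sem : Sem} (h : ExtOf Args att sem E) :
    ExtOf Args' att sem (E ∩ Args') := by
  have hc := h.completeExt
  cases sem with
  | grd =>
    refine ⟨hc.inter hD, fun E₂ h₂ => ?_⟩
    rw [← h₂.inter_defendedBy hD]
    exact Set.inter_subset_inter_left _ (h.2 _ (h₂.defendedBy hD))
  | cmp => exact hc.inter hD
  | prf =>
    refine ⟨hc.inter hD, fun E₂ h₂ hE => ?_⟩
    have hsub := defendedBy_mono (Args := Args) (Args' := Args') (att := att) hE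
    rw [hc.defendedBy_inter hD] at hsub
    rw [← h.2 _ (h₂.defendedBy hD) hsub, h₂.inter_defendedBy hD]
  | stb =>
    refine ⟨hc.inter hD, fun a ha hn => ?_⟩
    obtain ⟨b, hb, hba⟩ := h.2 a (hD.1 ha) fun h' => hn ⟨h', ha⟩
    obtain ⟨b', hb', hout⟩ := hc.exists_mem_inter hD hb
    exact ⟨b', hb', hout a hba⟩

theorem ExtOf.defendedBy (hD : Dominates Args Args' att) {sem : Sem}
    (h : ExtOf Args' att sem E') : ExtOf Args att sem (defendedBy Args Args' att E') := by
  have hc := h.completeExt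
  cases sem with
  | grd =>
    refine ⟨hc.defendedBy hD, fun E₂ h₂ => ?_⟩
    rw [← h₂.defendedBy_inter hD]
    exact defendedBy_mono (h.2 _ (h₂.inter hD))
  | cmp => exact hc.defendedBy hD
  | prf =>
    refine ⟨hc.defendedBy hD, fun E₂ h₂ hE => ?_⟩
    have hsub := Set.inter_subset_inter_left Args' hE
    rw [hc.inter_defendedBy hD] at hsub
    rw [← h.2 _ (h₂.inter hD) hsub, h₂.defendedBy_inter hD]
  | stb =>
    refine ⟨hc.defendedBy hD, fun a ha hn => ?_⟩
    by_contra! hna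
    refine hn ⟨ha, fun b hb hba => h.2 b hb fun hbE => ?_⟩
    exact hna b (hc.subset_defendedBy hD hbE) hba

end Dominates

theorem dominates_seqArg {F : Type} [DecidableEq F] (R : Set (Rule F)) (S A : Set F)
    (contrary : F → F) :
    Dominates {a | IsABAArg R S A a} {a | IsSeqArg R S A a} (Attacks contrary) := by
  refine ⟨fun _ ha => IsSeqArg.isABAArg ha, fun a ha => ?_⟩
  obtain ⟨b, hb, hconcl, hass⟩ := IsABAArg.exists_isSeqArg ha
  refine ⟨b, hb, fun c ⟨ψ, hψ, hac⟩ => ⟨ψ, hψ, hconcl.trans hac⟩, ?_⟩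
  exact fun c ⟨ψ, hψ, hcb⟩ => ⟨ψ, hass hψ, hcb⟩

/-- Skeptical (∩) entailment agrees between the ABA-framework and the corresponding
sequent-based ABA-framework, under each of the four semantics: every sem-extension of
the ABA-framework contains an ABA-argument for `φ` iff every sem-extension of the
sequent-based framework contains an assumptive sequent argument `A' ⟨ Γ ⇒ φ`
with `A' ⊆ A` and `Γ ⊆ S`. -/
theorem stmt2 {F V : Type} [DecidableEq F]
    (R : Set (Rule F)) (S A : Set F) (contrary : F → F) (atoms : F → Set V)
    (hA : A.Nonempty) (hSA : S ∩ A = ∅)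
    (hNT : ∀ φ : F, (∀ s ∈ S, Disjoint (atoms φ) (atoms s)) → ¬ Ded R S φ)
    (sem : Sem) (φ : F) :
    (∀ E, ExtOf {a | IsABAArg R S A a} (Attacks contrary) sem E →
        ∃ a ∈ E, (a.ass : Set F) ⊆ A ∧ (a.supp : Set F) ⊆ S ∧ a.concl = φ) ↔
    (∀ E, ExtOf {a | IsSeqArg R S A a} (Attacks contrary) sem E →
        ∃ a ∈ E, (a.ass : Set F) ⊆ A ∧ (a.supp : Set F) ⊆ S ∧ a.concl = φ) := by
  have hD := dominates_seqArg R S A contrary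
  constructor
  · intro h E' hE'
    obtain ⟨a, ha, -, -, rfl⟩ := h _ (hE'.defendedBy hD)
    obtain ⟨b, hb, hconcl, hass⟩ := IsABAArg.exists_isSeqArg ha.1
    refine ⟨b, hE'.completeExt.mem_iff.2 ⟨hb, ha.2.anti ?_⟩, hb.1, hb.2.1, hconcl⟩
    exact fun c ⟨ψ, hψ, hcb⟩ => ⟨ψ, hass hψ, hcb⟩
  · intro h E hE
    obtain ⟨a, ha, hrest⟩ := h _ (hE.inter hD)
    exact ⟨a, ha.1, hrest⟩
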